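/- Let E ⊆ 2^ℕ be a measurable set and ℱ a finite family of measurable functions from E to 2^ℕ. Then for every γ > 0 and every μ > 0 there exist η > 0 and a ∈ C^1_μ such that □_η(⋂_{F∈ℱ} F^{−1}[a]) ≥ □_γ(E). -/

import Mathlib

open MeasureTheory Filter Set Topology
open scoped ENNReal

noncomputable section

/-- The Cantor space `2^ℕ`. -/
abbrev Cantor : Type := ℕ → Bool

/-- The uniform product ("fair coin-flipping") probability measure on `2^ℕ`, realized as the
pushforward of Lebesgue measure on `[0,1)` under the binary-digit map. -/
noncomputable def cantorMeasure : Measure Cantor :=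
  Measure.map (fun x : ℝ => fun n : ℕ => decide (⌊x * 2 ^ (n + 1)⌋ % 2 = 1))
    (volume.restrict (Set.Ico (0 : ℝ) 1))

/-- The basic cylinder `[a]` determined by a finite binary sequence `a`. -/
def cyl (a : List Bool) : Set Cantor := {x | ∀ i : Fin a.length, x i = a.get i}

/-- `[A] = ⋃ a ∈ A, [a]`. -/
def cylSet (A : Set (List Bool)) : Set Cantor := ⋃ a ∈ A, cyl a

/-- The weight `2^(-|a|·r)` of a node `a`. -/
noncomputable def wt (r : ℝ) (a : List Bool) : ℝ≥0∞ := (2 : ℝ≥0∞) ^ (-(a.length : ℝ) * r)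

/-- `Σ_{a ∈ A} 2^(-|a|·r)`. -/
noncomputable def wtSum (r : ℝ) (A : Set (List Bool)) : ℝ≥0∞ := ∑' a : A, wt r (a : List Bool)

/-- `A ∈ C^∞_ε`, i.e. `Σ_{a ∈ A} 2^(-|a|·r) ≤ ε`. -/
def memCinf (r ε : ℝ) (A : Set (List Bool)) : Prop := wtSum r A ≤ ENNReal.ofReal ε

/-- The `r`-dimensional dyadic Hausdorff capacity `λ^r_∞`. -/
noncomputable def hcap (r : ℝ) (X : Set Cantor) : ℝ≥0∞ :=
  ⨅ (A : Set (List Bool)) (_ : X ⊆ cylSet A), wtSum r A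

/-- `□_δ(X) = inf {λ^r_∞(X \ Z) : Z measurable, λ Z < δ}`. -/
noncomputable def sqcap (r δ : ℝ) (X : Set Cantor) : ℝ≥0∞ :=
  ⨅ (Z : Set Cantor) (_ : MeasurableSet Z) (_ : cantorMeasure Z < ENNReal.ofReal δ),
    hcap r (X \ Z)

/-- The indicator that the colouring `c` vanishes on `H`, normalized to have average `1`. -/
noncomputable def normInd {T : Type*} (k : ℕ) (H : Finset T) (c : T → Fin (k + 1)) : ℝ :=
  ∏ t ∈ H, if c t = 0 then (k + 1 : ℝ) else 0

theorem normInd_nonneg {T : Type*} (k : ℕ) (H : Finset T) (c : T → Fin (k + 1)) :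
    0 ≤ normInd k H c :=
  Finset.prod_nonneg fun t _ => by split_ifs <;> positivity

theorem normInd_le {T : Type*} (k n : ℕ) (H : Finset T) (hH : H.card ≤ n)
    (c : T → Fin (k + 1)) : normInd k H c ≤ (k + 1 : ℝ) ^ n := by
  have h1 : normInd k H c ≤ ∏ _t ∈ H, (k + 1 : ℝ) :=
    Finset.prod_le_prod (fun t _ => by split_ifs <;> positivity)
      (fun t _ => by split_ifs <;> first | exact le_rfl | positivity)
  rw [Finset.prod_const] at h1
  exact h1.trans (pow_le_pow_right₀ (by linarith [(Nat.cast_nonneg k : (0 : ℝ) ≤ k)]) hH)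

theorem normInd_eq_zero {T : Type*} (k : ℕ) (H : Finset T) (c : T → Fin (k + 1))
    (h : ¬ ∀ t ∈ H, c t = 0) : normInd k H c = 0 := by
  push Not at h
  obtain ⟨t, ht, hc⟩ := h
  exact Finset.prod_eq_zero ht (if_neg hc)

theorem sum_normInd {T : Type*} [Fintype T] [DecidableEq T] (k : ℕ) (H : Finset T) :
    ∑ c : T → Fin (k + 1), normInd k H c = (k + 1 : ℝ) ^ Fintype.card T := by
  have h : ∀ c : T → Fin (k + 1), normInd k H c =
      ∏ t, if t ∈ H then (if c t = 0 then (k + 1 : ℝ) else 0) else 1 := by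
    intro c
    rw [normInd, Finset.prod_ite_mem, Finset.univ_inter]
  simp_rw [h]
  rw [← Fintype.piFinset_univ, ← Finset.prod_univ_sum (fun _ => Finset.univ)
    (fun t i => if t ∈ H then (if i = 0 then (k + 1 : ℝ) else 0) else 1)]
  rw [Finset.prod_congr rfl (g := fun _ => (k + 1 : ℝ)) ?_]
  · simp
  · intro t _
    by_cases ht : t ∈ H <;> simp [ht]

theorem normInd_mul {T : Type*} [DecidableEq T] (k : ℕ) {H K : Finset T}
    (h : Disjoint H K) (c : T → Fin (k + 1)) :
    normInd k H c * normInd k K c = normInd k (H ∪ K) c :=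
  (Finset.prod_union h).symm

theorem sum_card_zeros {T : Type*} [Fintype T] [DecidableEq T] (k : ℕ) :
    ∑ c : T → Fin (k + 1), (k + 1 : ℝ) * ((Finset.univ.filter fun t => c t = 0).card : ℝ) =
      Fintype.card T * (k + 1 : ℝ) ^ Fintype.card T := by
  have h : ∀ c : T → Fin (k + 1),
      (k + 1 : ℝ) * ((Finset.univ.filter fun t => c t = 0).card : ℝ) =
        ∑ t, normInd k {t} c := by
    intro c
    simp only [normInd, Finset.prod_singleton, Finset.sum_ite, Finset.sum_const, nsmul_eq_mul,
      mul_zero, add_zero]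
    ring
  simp_rw [h]
  rw [Finset.sum_comm]
  simp_rw [sum_normInd]
  simp

/-- Second moment bound for a weighted sum of normalized indicators, in terms of the weight of
intersecting pairs. -/
theorem sum_sq_normInd_le {T V : Type*} [Fintype T] [DecidableEq T] [Fintype V]
    (k n : ℕ) (H : V → Finset T) (hH : ∀ v, (H v).card ≤ n) (w u : V → ℝ)
    (hu0 : ∀ v, 0 ≤ u v) (huw : ∀ v, u v ≤ w v) :
    ∑ c : T → Fin (k + 1), (∑ v, u v * normInd k (H v) c - ∑ v, u v) ^ 2 ≤
      (k + 1 : ℝ) ^ Fintype.card T * ((k + 1 : ℝ) ^ (2 * n) *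
        ∑ v, ∑ v', if Disjoint (H v) (H v') then 0 else w v * w v') := by
  have hexp : ∀ c : T → Fin (k + 1), (∑ v, u v * normInd k (H v) c - ∑ v, u v) ^ 2 =
      ∑ v, ∑ v', u v * u v' *
        (normInd k (H v) c * normInd k (H v') c - normInd k (H v) c - normInd k (H v') c + 1) := by
    intro c
    rw [← Finset.sum_sub_distrib, sq, Finset.sum_mul_sum]
    refine Finset.sum_congr rfl fun v _ => Finset.sum_congr rfl fun v' _ => by ring
  simp_rw [hexp]
  rw [Finset.sum_comm, Finset.mul_sum, Finset.mul_sum]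
  refine Finset.sum_le_sum fun v _ => ?_
  rw [Finset.sum_comm, Finset.mul_sum, Finset.mul_sum]
  refine Finset.sum_le_sum fun v' _ => ?_
  rw [← Finset.mul_sum, Finset.sum_add_distrib, Finset.sum_sub_distrib, Finset.sum_sub_distrib,
    sum_normInd, sum_normInd]
  have hone : ∑ _c : T → Fin (k + 1), (1 : ℝ) = (k + 1 : ℝ) ^ Fintype.card T := by simp
  rw [hone]
  split_ifs with hd
  · simp_rw [normInd_mul k hd]
    rw [sum_normInd]
    simp
  · have hle : ∑ c : T → Fin (k + 1), normInd k (H v) c * normInd k (H v') c ≤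
        (k + 1 : ℝ) ^ Fintype.card T * (k + 1 : ℝ) ^ (2 * n) := by
      rw [← hone, Finset.sum_mul]
      refine Finset.sum_le_sum fun c _ => ?_
      rw [one_mul, two_mul, pow_add]
      exact mul_le_mul (normInd_le k n _ (hH v) c) (normInd_le k n _ (hH v') c)
        (normInd_nonneg _ _ _) (by positivity)
    have hp : (0 : ℝ) ≤ (k + 1 : ℝ) ^ Fintype.card T := by positivity
    calc _ ≤ u v * u v' * ((k + 1 : ℝ) ^ Fintype.card T * (k + 1 : ℝ) ^ (2 * n)) :=
          mul_le_mul_of_nonneg_left (by linarith) (mul_nonneg (hu0 v) (hu0 v'))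
      _ ≤ w v * w v' * ((k + 1 : ℝ) ^ Fintype.card T * (k + 1 : ℝ) ^ (2 * n)) :=
          mul_le_mul_of_nonneg_right
            (mul_le_mul (huw v) (huw v') (hu0 v') ((hu0 v).trans (huw v))) (by positivity)
      _ = _ := by ring

/-- A small set of colours containing the finite set attached to a fixed proportion of the points,
simultaneously for finitely many subweights `u b` of `w` of mass at least `γ`. -/
theorem exists_small_capturing_finset {T V ι : Type*} [Fintype T] [DecidableEq T] [Nonempty T]
    [Fintype V] [Fintype ι] (k n : ℕ) (H : V → Finset T) (hH : ∀ v, (H v).card ≤ n)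
    (w : V → ℝ) (hw0 : ∀ v, 0 ≤ w v) (hw1 : ∑ v, w v ≤ 1)
    (u : ι → V → ℝ) (hu0 : ∀ b v, 0 ≤ u b v) (huw : ∀ b v, u b v ≤ w v)
    (γ ε : ℝ) (hγ : 0 < γ) (hε : 0 < ε)
    (hεγ : 8 * Fintype.card ι * (k + 1 : ℝ) ^ (2 * n) * n * ε ≤ γ ^ 2) :
    ∃ a : Finset T, (a.card : ℝ) ≤ 2 * Fintype.card T / (k + 1 : ℝ) + n / ε ∧
      ∀ b, γ ≤ ∑ v, u b v →
        γ / (2 * (k + 1 : ℝ) ^ n) ≤ ∑ v with H v ⊆ a, u b v := by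
  classical
  set M : ℝ := (Fintype.card T : ℝ) with hM
  have hMpos : 0 < M := by rw [hM]; exact_mod_cast Fintype.card_pos
  set deg : T → ℝ := fun t => ∑ v with t ∈ H v, w v with hdeg
  set S : Finset T := Finset.univ.filter fun t => ε ≤ deg t with hS
  have hdeg0 : ∀ t, 0 ≤ deg t := fun t => Finset.sum_nonneg fun v _ => hw0 v
  have hScard : (S.card : ℝ) ≤ n / ε := by
    rw [le_div_iff₀ hε]
    calc (S.card : ℝ) * ε = ∑ t ∈ S, ε := by simp
      _ ≤ ∑ t ∈ S, deg t := Finset.sum_le_sum fun t ht => (Finset.mem_filter.1 ht).2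
      _ ≤ ∑ t, deg t := Finset.sum_le_univ_sum_of_nonneg hdeg0
      _ = ∑ v, ∑ t, if t ∈ H v then w v else 0 := by
          simp_rw [hdeg, Finset.sum_filter]
          exact Finset.sum_comm
      _ = ∑ v, (H v).card * w v := by simp
      _ ≤ ∑ v, n * w v := Finset.sum_le_sum fun v _ =>
          mul_le_mul_of_nonneg_right (by exact_mod_cast hH v) (hw0 v)
      _ ≤ n := by
          rw [← Finset.mul_sum]
          exact mul_le_of_le_one_right (Nat.cast_nonneg n) hw1
  set H' : V → Finset T := fun v => H v \ S with hH'
  have hH'n : ∀ v, (H' v).card ≤ n := fun v =>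
    (Finset.card_le_card Finset.sdiff_subset).trans (hH v)
  have hpairs : ∑ v, ∑ v', (if Disjoint (H' v) (H' v') then 0 else w v * w v') ≤ n * ε := by
    have h1 : ∀ v, ∑ v', (if Disjoint (H' v) (H' v') then 0 else w v * w v') ≤ w v * (n * ε) := by
      intro v
      calc ∑ v', (if Disjoint (H' v) (H' v') then 0 else w v * w v')
          ≤ ∑ v', ∑ t ∈ H' v, (if t ∈ H v' then w v * w v' else 0) := by
            refine Finset.sum_le_sum fun v' _ => ?_
            have hnn : ∀ t ∈ H' v, (0 : ℝ) ≤ if t ∈ H v' then w v * w v' else 0 := fun t _ => by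
              split_ifs
              · exact mul_nonneg (hw0 _) (hw0 _)
              · exact le_rfl
            split_ifs with hd
            · exact Finset.sum_nonneg hnn
            · obtain ⟨t, ht, ht'⟩ := Finset.not_disjoint_iff.1 hd
              have := Finset.single_le_sum hnn ht
              rwa [if_pos (Finset.mem_sdiff.1 ht').1] at this
        _ = ∑ t ∈ H' v, w v * deg t := by
            rw [Finset.sum_comm]
            refine Finset.sum_congr rfl fun t _ => ?_
            rw [hdeg, Finset.mul_sum, Finset.sum_filter]
        _ ≤ ∑ t ∈ H' v, w v * ε := by
            refine Finset.sum_le_sum fun t ht => mul_le_mul_of_nonneg_left ?_ (hw0 v)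
            have := (Finset.mem_sdiff.1 ht).2
            rw [hS, Finset.mem_filter] at this
            push Not at this
            exact (this (Finset.mem_univ _)).le
        _ = (H' v).card * (w v * ε) := by simp
        _ ≤ n * (w v * ε) := mul_le_mul_of_nonneg_right (by exact_mod_cast hH'n v)
            (mul_nonneg (hw0 v) hε.le)
        _ = _ := by ring
    calc _ ≤ ∑ v, w v * (n * ε) := Finset.sum_le_sum fun v _ => h1 v
      _ ≤ n * ε := by
          rw [← Finset.sum_mul]
          exact mul_le_of_le_one_left (by positivity) hw1
  set P : ℝ := (k + 1 : ℝ) ^ Fintype.card T with hP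
  have hPpos : 0 < P := by positivity
  set dev : ι → (T → Fin (k + 1)) → ℝ :=
    fun b c => (∑ v, u b v * normInd k (H' v) c - ∑ v, u b v) ^ 2 with hdev
  have hvar : ∀ b, ∑ c, dev b c ≤ P * ((k + 1 : ℝ) ^ (2 * n) * (n * ε)) := fun b =>
    (sum_sq_normInd_le k n H' hH'n w (u b) (hu0 b) (huw b)).trans (by gcongr)
  obtain ⟨c, -, hc⟩ : ∃ c ∈ (Finset.univ : Finset (T → Fin (k + 1))),
      (k + 1 : ℝ) * ((Finset.univ.filter fun t => c t = 0).card : ℝ) +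
        M * (8 / γ ^ 2) * ∑ b, dev b c ≤ 2 * M := by
    refine Finset.exists_le_of_sum_le Finset.univ_nonempty ?_
    rw [Finset.sum_add_distrib, sum_card_zeros, ← Finset.mul_sum, Finset.sum_comm]
    have h2 : ∑ b, ∑ c, dev b c ≤
        Fintype.card ι * (P * ((k + 1 : ℝ) ^ (2 * n) * (n * ε))) := by
      refine (Finset.sum_le_sum fun b _ => hvar b).trans ?_
      simp
    have h3 : M * (8 / γ ^ 2) * ∑ b, ∑ c, dev b c ≤ M * P := by
      calc _ ≤ M * (8 / γ ^ 2) * (Fintype.card ι * (P * ((k + 1 : ℝ) ^ (2 * n) * (n * ε)))) := by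
            gcongr
        _ = M * P * ((8 * Fintype.card ι * (k + 1 : ℝ) ^ (2 * n) * n * ε) / γ ^ 2) := by ring
        _ ≤ M * P * 1 := by
            gcongr
            exact (div_le_one (by positivity)).2 hεγ
        _ = M * P := mul_one _
    have h4 : ∑ _c : T → Fin (k + 1), 2 * M = P * (2 * M) := by simp [hP]
    rw [h4]
    linarith
  have hdev0 : ∀ b c, 0 ≤ dev b c := fun b c => sq_nonneg _
  refine ⟨(Finset.univ.filter fun t => c t = 0) ∪ S, ?_, ?_⟩
  · have h5 : (k + 1 : ℝ) * ((Finset.univ.filter fun t => c t = 0).card : ℝ) ≤ 2 * M := by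
      have : 0 ≤ M * (8 / γ ^ 2) * ∑ b, dev b c :=
        mul_nonneg (by positivity) (Finset.sum_nonneg fun b _ => hdev0 b c)
      linarith
    have h6 : ((Finset.univ.filter fun t => c t = 0).card : ℝ) ≤ 2 * M / (k + 1) := by
      rw [le_div_iff₀ (by positivity)]
      linarith
    have h7 : (((Finset.univ.filter fun t => c t = 0) ∪ S).card : ℝ) ≤
        (Finset.univ.filter fun t => c t = 0).card + S.card := by
      exact_mod_cast Finset.card_union_le _ _
    linarith
  · intro b hb
    have h8 : dev b c ≤ (γ / 2) ^ 2 := by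
      have h9 : dev b c ≤ ∑ b, dev b c :=
        Finset.single_le_sum (fun b _ => hdev0 b c) (Finset.mem_univ b)
      have h10 : M * (8 / γ ^ 2) * dev b c ≤ 2 * M := by
        have : M * (8 / γ ^ 2) * dev b c ≤ M * (8 / γ ^ 2) * ∑ b, dev b c := by gcongr
        have : 0 ≤ (k + 1 : ℝ) * ((Finset.univ.filter fun t => c t = 0).card : ℝ) := by positivity
        linarith
      have h11 : 8 / γ ^ 2 * dev b c ≤ 2 := by
        refine le_of_mul_le_mul_left ?_ hMpos
        linarith
      rw [div_mul_eq_mul_div, div_le_iff₀ (by positivity)] at h11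
      linarith
    have h12 := abs_le_of_sq_le_sq' h8 (by positivity)
    have h13 : γ / 2 ≤ ∑ v, u b v * normInd k (H' v) c := by linarith [h12.1]
    have h14 : ∑ v, u b v * normInd k (H' v) c ≤
        (k + 1 : ℝ) ^ n *
          ∑ v with H v ⊆ (Finset.univ.filter fun t => c t = 0) ∪ S, u b v := by
      rw [Finset.mul_sum, Finset.sum_filter]
      refine Finset.sum_le_sum fun v _ => ?_
      split_ifs with hv
      · rw [mul_comm]
        exact mul_le_mul_of_nonneg_right (normInd_le k n _ (hH'n v) c) (hu0 b v)
      · rw [normInd_eq_zero, mul_zero]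
        contrapose! hv
        intro t ht
        by_cases hts : t ∈ S
        · exact Finset.mem_union_right _ hts
        · exact Finset.mem_union_left _
            (Finset.mem_filter.2 ⟨Finset.mem_univ _, hv t (Finset.mem_sdiff.2 ⟨ht, hts⟩)⟩)
    rw [div_le_iff₀ (by positivity)]
    linarith

theorem measurable_binaryDigits :
    Measurable (fun x : ℝ => fun n : ℕ => decide (⌊x * 2 ^ (n + 1)⌋ % 2 = 1)) := by
  refine measurable_pi_lambda _ fun n => ?_
  exact (measurable_from_top (f := fun z : ℤ => decide (z % 2 = 1))).comp
    (Int.measurable_floor.comp (measurable_id.mul_const _))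

instance : IsProbabilityMeasure cantorMeasure := by
  refine ⟨?_⟩
  rw [cantorMeasure, Measure.map_apply measurable_binaryDigits MeasurableSet.univ]
  simp

theorem measurableSet_cyl (a : List Bool) : MeasurableSet (cyl a) := by
  have : cyl a = ⋂ i : Fin a.length, (fun x : Cantor => x i) ⁻¹' {a.get i} := by
    ext x
    simp [cyl]
  rw [this]
  exact MeasurableSet.iInter fun i => measurable_pi_apply _ (MeasurableSet.singleton _)

theorem measurableSet_cylSet (A : Set (List Bool)) : MeasurableSet (cylSet A) :=
  MeasurableSet.biUnion (Set.to_countable A) fun a _ => measurableSet_cyl a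

theorem floor_mul_two_pow_succ_ediv_two (x : ℝ) (k : ℕ) :
    ⌊x * 2 ^ (k + 1)⌋ / 2 = ⌊x * 2 ^ k⌋ := by
  symm
  rw [Int.floor_eq_iff]
  have h1 := Int.floor_le (x * 2 ^ (k + 1))
  have h2 := Int.lt_floor_add_one (x * 2 ^ (k + 1))
  set z := ⌊x * 2 ^ (k + 1)⌋
  have h3 : 2 * (z / 2) ≤ z := by omega
  have h4 : z ≤ 2 * (z / 2) + 1 := by omega
  have h3' : (2 : ℝ) * ((z / 2 : ℤ) : ℝ) ≤ z := by exact_mod_cast h3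
  have h4' : (z : ℝ) ≤ 2 * ((z / 2 : ℤ) : ℝ) + 1 := by exact_mod_cast h4
  rw [pow_succ] at h1 h2
  constructor <;> linarith

theorem floor_mul_two_pow_eq_of_digits {x y : ℝ} (hx : x ∈ Set.Ico (0 : ℝ) 1)
    (hy : y ∈ Set.Ico (0 : ℝ) 1) (L : ℕ)
    (h : ∀ k < L, decide (⌊x * 2 ^ (k + 1)⌋ % 2 = 1) = decide (⌊y * 2 ^ (k + 1)⌋ % 2 = 1)) :
    ⌊x * 2 ^ L⌋ = ⌊y * 2 ^ L⌋ := by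
  induction L with
  | zero =>
    rw [pow_zero, mul_one, mul_one, Int.floor_eq_zero_iff.2 hx, Int.floor_eq_zero_iff.2 hy]
  | succ L ih =>
    have h1 := ih fun k hk => h k (by omega)
    rw [← floor_mul_two_pow_succ_ediv_two x, ← floor_mul_two_pow_succ_ediv_two y] at h1
    have h2 := decide_eq_decide.1 (h L (by omega))
    omega

theorem wt_one (a : List Bool) : wt 1 a = ENNReal.ofReal (1 / 2 ^ a.length) := by
  rw [wt, mul_one, ENNReal.rpow_neg, ENNReal.rpow_natCast, one_div,
    ENNReal.ofReal_inv_of_pos (by positivity), ENNReal.ofReal_pow (by norm_num)]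
  norm_num

theorem cantorMeasure_cyl_le (a : List Bool) : cantorMeasure (cyl a) ≤ wt 1 a := by
  rw [cantorMeasure, Measure.map_apply measurable_binaryDigits (measurableSet_cyl a),
    Measure.restrict_apply (measurable_binaryDigits (measurableSet_cyl a)), wt_one]
  set S := (fun x : ℝ => fun n : ℕ => decide (⌊x * 2 ^ (n + 1)⌋ % 2 = 1)) ⁻¹' cyl a ∩
    Set.Ico (0 : ℝ) 1 with hS
  rcases S.eq_empty_or_nonempty with h | ⟨y, hy, hy1⟩
  · simp [h]
  · set z := ⌊y * 2 ^ a.length⌋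
    have hsub : S ⊆ Set.Ico ((z : ℝ) / 2 ^ a.length) ((z + 1 : ℝ) / 2 ^ a.length) := by
      rintro x ⟨hx, hx1⟩
      have hz : ⌊x * 2 ^ a.length⌋ = z := floor_mul_two_pow_eq_of_digits hx1 hy1 _ fun k hk =>
        (hx ⟨k, hk⟩).trans (hy ⟨k, hk⟩).symm
      have := Int.floor_eq_iff.1 hz
      rw [Set.mem_Ico, div_le_iff₀ (by positivity), lt_div_iff₀ (by positivity)]
      exact this
    refine (measure_mono hsub).trans ?_
    rw [Real.volume_Ico]
    exact le_of_eq (by congr 1; ring)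

theorem cantorMeasure_cylSet_le (A : Set (List Bool)) :
    cantorMeasure (cylSet A) ≤ wtSum 1 A :=
  (measure_biUnion_le _ (Set.to_countable A) _).trans
    (ENNReal.tsum_le_tsum fun a => cantorMeasure_cyl_le a)

theorem wt_one_le {r : ℝ} (hr : r < 1) {m : ℕ} {a : List Bool} (ha : m ≤ a.length) :
    wt 1 a ≤ (2 : ℝ≥0∞) ^ (-(m : ℝ) * (1 - r)) * wt r a := by
  rw [wt, wt, ← ENNReal.rpow_add _ _ (by norm_num) (by norm_num)]
  refine ENNReal.rpow_le_rpow_of_exponent_le (by norm_num) ?_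
  have : (m : ℝ) ≤ a.length := by exact_mod_cast ha
  nlinarith

theorem wtSum_mono (r : ℝ) {A B : Set (List Bool)} (h : A ⊆ B) : wtSum r A ≤ wtSum r B :=
  ENNReal.tsum_mono_subtype _ h

theorem cantorMeasure_cylSet_long_le {r : ℝ} (hr : r < 1) (m : ℕ) (A : Set (List Bool))
    (hA : wtSum r A ≤ 1) :
    cantorMeasure (cylSet {a ∈ A | m ≤ a.length}) ≤ (2 : ℝ≥0∞) ^ (-(m : ℝ) * (1 - r)) := by
  refine (cantorMeasure_cylSet_le _).trans ?_
  calc wtSum 1 {a ∈ A | m ≤ a.length}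
      ≤ ∑' a : {a ∈ A | m ≤ a.length}, (2 : ℝ≥0∞) ^ (-(m : ℝ) * (1 - r)) * wt r (a : List Bool) :=
        ENNReal.tsum_le_tsum fun a => wt_one_le hr a.2.2
    _ = (2 : ℝ≥0∞) ^ (-(m : ℝ) * (1 - r)) * wtSum r {a ∈ A | m ≤ a.length} :=
        ENNReal.tsum_mul_left
    _ ≤ (2 : ℝ≥0∞) ^ (-(m : ℝ) * (1 - r)) * 1 := by
        gcongr
        exact (wtSum_mono r (Set.sep_subset _ _)).trans hA
    _ = _ := mul_one _

theorem cylSet_union (A B : Set (List Bool)) : cylSet (A ∪ B) = cylSet A ∪ cylSet B :=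
  Set.biUnion_union A B _

theorem sqcap_le_one (r : ℝ) {δ : ℝ} (hδ : 0 < δ) (X : Set Cantor) : sqcap r δ X ≤ 1 := by
  refine (iInf₂_le_of_le ∅ MeasurableSet.empty (iInf_le _ (by simpa using hδ))).trans ?_
  refine (iInf₂_le ({[]} : Set (List Bool)) ?_).trans ?_
  · intro x _
    exact Set.mem_biUnion (Set.mem_singleton _) fun i => i.elim0
  · rw [wtSum, tsum_singleton ([] : List Bool) (wt r)]
    simp [wt]

theorem exists_two_rpow_neg_le {r : ℝ} (hr : r < 1) {η : ℝ} (hη : 0 < η) :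
    ∃ m : ℕ, (2 : ℝ≥0∞) ^ (-(m : ℝ) * (1 - r)) ≤ ENNReal.ofReal η := by
  have hb : (2 : ℝ) ^ (-(1 - r)) < 1 :=
    Real.rpow_lt_one_of_one_lt_of_neg (by norm_num) (by linarith)
  obtain ⟨m, hm⟩ := exists_pow_lt_of_lt_one hη hb
  refine ⟨m, ?_⟩
  have : (2 : ℝ≥0∞) = ENNReal.ofReal 2 := by norm_num
  rw [this, ENNReal.ofReal_rpow_of_pos (by norm_num)]
  refine ENNReal.ofReal_le_ofReal ?_
  rw [← Real.rpow_natCast, ← Real.rpow_mul (by norm_num)] at hm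
  rw [show -(m : ℝ) * (1 - r) = -(1 - r) * m by ring]
  exact hm.le

/-- If every set missed by a cover of total weight at most `1` and having measure at least `γ` in
`E` also has measure at least `η` in `G`, then the capacity of `E` is bounded by that of `G`. -/
theorem sqcap_le_sqcap_of_measure {r γ η : ℝ} (hγ : 0 < γ) {E G : Set Cantor}
    (hE : MeasurableSet E)
    (h : ∀ A : Set (List Bool), wtSum r A ≤ 1 →
      ENNReal.ofReal γ ≤ cantorMeasure (E \ cylSet A) →
        ENNReal.ofReal η ≤ cantorMeasure (G \ cylSet A)) :
    sqcap r γ E ≤ sqcap r η G := by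
  refine le_iInf₂ fun Z _ => le_iInf fun hZ => le_iInf₂ fun A hA => ?_
  by_contra! hlt
  have hA1 : wtSum r A ≤ 1 := hlt.le.trans (sqcap_le_one r hγ E)
  have hEA : ENNReal.ofReal γ ≤ cantorMeasure (E \ cylSet A) := by
    by_contra! hsmall
    refine hlt.not_ge ?_
    refine (iInf₂_le_of_le (E \ cylSet A) (hE.diff (measurableSet_cylSet A))
      (iInf_le _ hsmall)).trans (iInf₂_le A ?_)
    intro x hx
    by_contra hxA
    exact hx.2 ⟨hx.1, hxA⟩
  have hsub : G \ cylSet A ⊆ Z := by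
    intro x hx
    by_contra hxZ
    exact hx.2 (hA ⟨hx.1, hxZ⟩)
  exact ((h A hA1 hEA).trans (measure_mono hsub)).not_gt hZ

theorem cyl_ofFn {L : ℕ} (t : Fin L → Bool) : cyl (List.ofFn t) = {x | ∀ i, x i = t i} := by
  ext x
  simp only [cyl, Set.mem_ofPred_eq]
  constructor
  · intro h i
    have := h ⟨i, by simp⟩
    simpa using this
  · intro h i
    have := h ⟨i, by simpa using i.2⟩
    simpa using this

theorem wtSum_one_ofFn_image {L : ℕ} (a : Finset (Fin L → Bool)) :
    wtSum 1 (List.ofFn '' (a : Set (Fin L → Bool))) ≤ ENNReal.ofReal (a.card / 2 ^ L) := by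
  classical
  have h : List.ofFn '' (a : Set (Fin L → Bool)) =
      ((a.image List.ofFn : Finset (List Bool)) : Set _) := by
    simp
  rw [h, wtSum, Finset.tsum_subtype' (a.image List.ofFn) (wt 1), Finset.sum_image
    (fun x _ y _ hxy => List.ofFn_injective hxy)]
  refine le_of_eq ?_
  simp only [wt_one, List.length_ofFn, Finset.sum_const, nsmul_eq_mul]
  rw [← ENNReal.ofReal_natCast, ← ENNReal.ofReal_mul (by positivity)]
  congr 1
  ring

/-- A small clopen set which captures, under finitely many measurable maps, a fixed proportion of
each member of a finite family of sets of measure at least `γ`. -/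
theorem exists_small_capturing_cylSet {n k : ℕ} {F : Fin n → Cantor → Cantor}
    (hF : ∀ j, Measurable (F j)) {μ₀ γ : ℝ} (hγ : 0 < γ) (hμ : 0 < μ₀)
    (hk : 4 / μ₀ ≤ k + 1) {ι : Type*} [Finite ι] (B : ι → Set Cantor) :
    ∃ a : Set (List Bool), memCinf 1 μ₀ a ∧ ∀ b, γ ≤ cantorMeasure.real (B b) →
      γ / (2 * (k + 1 : ℝ) ^ n) ≤
        cantorMeasure.real (B b ∩ ⋂ j, F j ⁻¹' cylSet a) := by
  classical
  have := Fintype.ofFinite ι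
  set C : ℝ := 8 * Fintype.card ι * (k + 1 : ℝ) ^ (2 * n) * n with hC
  have hC0 : 0 ≤ C := by positivity
  set ε : ℝ := γ ^ 2 / (C + 1) with hε
  have hε0 : 0 < ε := by positivity
  obtain ⟨L, hL⟩ : ∃ L : ℕ, n / ε / (μ₀ / 2) < 2 ^ L := pow_unbounded_of_one_lt _ (by norm_num)
  set f : Cantor → Fin n → Fin L → Bool := fun x j i => F j x i with hf
  have hfm : Measurable f := measurable_pi_lambda _ fun j => measurable_pi_lambda _ fun i =>
    (measurable_pi_apply _).comp (hF j)
  have hsing : ∀ v, MeasurableSet (f ⁻¹' {v}) := fun v => hfm (MeasurableSet.singleton v)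
  have hsum : ∀ (ν : Measure Cantor) [IsFiniteMeasure ν] (s : Finset (Fin n → Fin L → Bool)),
      ∑ v ∈ s, ν.real (f ⁻¹' {v}) = ν.real (f ⁻¹' s) := fun ν _ s =>
    sum_measureReal_preimage_singleton s fun v _ => hsing v
  obtain ⟨a, ha, hcap⟩ := exists_small_capturing_finset k n
    (fun v : Fin n → Fin L → Bool => Finset.univ.image v)
    (fun v => Finset.card_image_le.trans (by simp))
    (fun v => cantorMeasure.real (f ⁻¹' {v})) (fun v => measureReal_nonneg)
    (by rw [hsum]; exact measureReal_le_one)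
    (fun b v => (cantorMeasure.restrict (B b)).real (f ⁻¹' {v})) (fun b v => measureReal_nonneg)
    (fun b v => ENNReal.toReal_mono (measure_ne_top _ _) (Measure.restrict_apply_le _ _))
    γ ε hγ hε0 (by
      change C * ε ≤ γ ^ 2
      rw [hε, mul_div_assoc', div_le_iff₀ (by positivity)]
      nlinarith [sq_nonneg γ])
  refine ⟨List.ofFn '' (a : Set (Fin L → Bool)), ?_, fun b hb => ?_⟩
  · refine (wtSum_one_ofFn_image a).trans (ENNReal.ofReal_le_ofReal ?_)
    have hcard : (Fintype.card (Fin L → Bool) : ℝ) = 2 ^ L := by simp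
    rw [hcard] at ha
    rw [div_le_iff₀ (by positivity)]
    rw [div_lt_iff₀ (by positivity)] at hL
    have h1 : 2 * (2 : ℝ) ^ L / (k + 1) ≤ μ₀ / 2 * 2 ^ L := by
      rw [div_le_iff₀ (by positivity)]
      rw [div_le_iff₀ hμ] at hk
      have : (0 : ℝ) < 2 ^ L := by positivity
      nlinarith
    linarith
  · have h1 := hcap b (by
      rw [hsum]
      simpa [measureReal_def] using hb)
    rw [hsum] at h1
    refine h1.trans ?_
    rw [measureReal_restrict_apply (hfm (Finset.measurableSet _))]
    refine measureReal_mono ?_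
    rintro x ⟨hx, hxB⟩
    refine ⟨hxB, Set.mem_iInter.2 fun j => ?_⟩
    have hx' : Finset.univ.image (f x) ⊆ a := by simpa using hx
    refine Set.mem_biUnion (Set.mem_image_of_mem _
      (hx' (Finset.mem_image_of_mem _ (Finset.mem_univ j)))) ?_
    rw [cyl_ofFn]
    exact fun i => rfl

theorem exists_measurable_extension {E : Set Cantor} (hE : MeasurableSet E)
    {f : Cantor → Cantor} (hf : Measurable (E.domRestrict f)) :
    ∃ g : Cantor → Cantor, Measurable g ∧ ∀ x ∈ E, g x = f x := by
  classical
  refine ⟨E.piecewise f fun _ _ => false, ?_, fun x hx => Set.piecewise_eq_of_mem _ _ _ hx⟩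
  refine measurable_of_restrict_of_restrict_compl hE ?_ ?_
  · rwa [Set.domRestrict_piecewise]
  · rw [Set.domRestrict_piecewise_compl]
    exact measurable_const

theorem statement4 (r : ℝ) (hr0 : 0 < r) (hr1 : r < 1)
    (E : Set Cantor) (hE : MeasurableSet E)
    (n : ℕ) (F : Fin n → Cantor → Cantor)
    (hFmeas : ∀ j, Measurable (E.restrict (F j)))
    (γ μ₀ : ℝ) (hγ : 0 < γ) (hμ : 0 < μ₀) :
    ∃ η : ℝ, 0 < η ∧ ∃ a : Set (List Bool), memCinf 1 μ₀ a ∧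
      sqcap r γ E ≤ sqcap r η (⋂ j : Fin n, E ∩ F j ⁻¹' cylSet a) := by
  classical
  obtain ⟨k, hk⟩ := exists_nat_ge (4 / μ₀)
  have hk' : 4 / μ₀ ≤ k + 1 := hk.trans (by linarith)
  set η : ℝ := γ / (4 * (k + 1 : ℝ) ^ n) with hη
  have hη0 : 0 < η := by positivity
  obtain ⟨m, hm⟩ := exists_two_rpow_neg_le hr1 hη0
  have : Finite {l : List Bool // l.length < m} := List.finite_length_lt Bool m
  choose F' hF' hFF' using fun j => exists_measurable_extension hE (hFmeas j)
  obtain ⟨a, ha, hcap⟩ := exists_small_capturing_cylSet hF' hγ hμ hk'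
    (fun s : Set {l : List Bool // l.length < m} => E \ cylSet (Subtype.val '' s))
  refine ⟨η, hη0, a, ha, sqcap_le_sqcap_of_measure hγ hE fun A hA hEA => ?_⟩
  set s : Set {l : List Bool // l.length < m} := {l | l.1 ∈ A} with hs
  have hsplit : cylSet A =
      cylSet (Subtype.val '' s) ∪ cylSet {l ∈ A | m ≤ l.length} := by
    rw [← cylSet_union]
    congr 1
    ext l
    by_cases hl : l.length < m <;> simp [hs, hl, not_le.2, not_lt.1]
  have h1 : γ ≤ cantorMeasure.real (E \ cylSet (Subtype.val '' s)) := by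
    rw [measureReal_def, ← ENNReal.ofReal_le_iff_le_toReal (measure_ne_top _ _)]
    refine hEA.trans (measure_mono (Set.sdiff_subset_sdiff_right ?_))
    rw [hsplit]
    exact Set.subset_union_left
  have h2 := hcap s h1
  have h3 : cantorMeasure.real (cylSet {l ∈ A | m ≤ l.length}) ≤ η :=
    ENNReal.toReal_le_of_le_ofReal hη0.le ((cantorMeasure_cylSet_long_le hr1 m A hA).trans hm)
  rw [ENNReal.ofReal_le_iff_le_toReal (measure_ne_top _ _), ← measureReal_def]
  have h4 : cantorMeasure.real ((E \ cylSet (Subtype.val '' s)) ∩ ⋂ j, F' j ⁻¹' cylSet a) ≤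
      cantorMeasure.real ((⋂ j : Fin n, E ∩ F j ⁻¹' cylSet a) \ cylSet A) +
        cantorMeasure.real (cylSet {l ∈ A | m ≤ l.length}) := by
    refine (measureReal_mono ?_).trans (measureReal_union_le _ _)
    rintro x ⟨⟨hxE, hxs⟩, hxF⟩
    by_cases hxl : x ∈ cylSet {l ∈ A | m ≤ l.length}
    · exact Or.inr hxl
    · refine Or.inl ⟨Set.mem_iInter.2 fun j => ⟨hxE, ?_⟩, ?_⟩
      · have := Set.mem_iInter.1 hxF j
        rwa [Set.mem_preimage, hFF' j x hxE] at this
      · rw [hsplit]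
        rintro (h | h)
        exacts [hxs h, hxl h]
  have h5 : γ / (2 * (k + 1 : ℝ) ^ n) = 2 * η := by
    rw [hη]
    field_simp
    norm_num
  linarith
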